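/- Let V be a local closed conformal vector field without zeros on a Riemannian manifold 𝕄ⁿ, i.e. ∇^{𝕄ⁿ}_X V = f X for some non-vanishing function f and all vector fields X. Then 𝕄ⁿ has locally the structure of a warped product of an interval of the Euclidean line with an (n−1)-dimensional Riemannian manifold: around each point there are coordinates in which the metric takes the form g = dt² + h(t)² g_{M^{n−1}}. -/

import Mathlib

noncomputable section
open Real Set

/-- Points of the coordinate chart `ℝⁿ`. -/
abbrev Pt (n : ℕ) := Fin n → ℝ

/-- The `i`-th standard coordinate vector. -/
def stdb (n : ℕ) (i : Fin n) : Pt n := Pi.single i 1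

/-- Riemannian metric data in coordinates: a field of symmetric bilinear forms. -/
abbrev Met (n : ℕ) := Pt n → Fin n → Fin n → ℝ

/-- The inner product of the vectors `v`, `w` at the point `x`, with respect to `g`. -/
def minner {n : ℕ} (g : Met n) (x v w : Pt n) : ℝ := ∑ i, ∑ j, g x i j * v i * w j

/-- `g` is a smooth Riemannian metric on `U`. -/
def IsMetricOn {n : ℕ} (U : Set (Pt n)) (g : Met n) : Prop :=
  (∀ i j, ContDiffOn ℝ (⊤ : ℕ∞) (fun x => g x i j) U) ∧
  (∀ x i j, g x i j = g x j i) ∧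
  (∀ x ∈ U, ∀ v : Pt n, v ≠ 0 → 0 < minner g x v v)

/-- The inverse metric `g^{kl}`. -/
def ginv {n : ℕ} (g : Met n) (x : Pt n) : Fin n → Fin n → ℝ :=
  fun k l => (Matrix.of (g x))⁻¹ k l

/-- The Christoffel symbols `Γᵏᵢⱼ` of the Levi-Civita connection of `g`. -/
def christoffel {n : ℕ} (g : Met n) (x : Pt n) (k i j : Fin n) : ℝ :=
  (1/2) * ∑ l, ginv g x k l *
    (fderiv ℝ (fun y => g y j l) x (stdb n i) + fderiv ℝ (fun y => g y i l) x (stdb n j)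
      - fderiv ℝ (fun y => g y i j) x (stdb n l))

/-- The covariant derivative (Levi-Civita connection of `g`) of the vector field `Y`
at the point `x` in the direction `v`. -/
def covD {n : ℕ} (g : Met n) (Y : Pt n → Pt n) (x v : Pt n) : Pt n :=
  fun k => fderiv ℝ (fun y => Y y k) x v + ∑ i, ∑ j, christoffel g x k i j * v i * Y x j

/-- `X` is a Killing field of `g` on `U`. -/
def IsKillingOn {n : ℕ} (U : Set (Pt n)) (g : Met n) (X : Pt n → Pt n) : Prop :=
  ∀ x ∈ U, ∀ v w : Pt n,
    minner g x (covD g X x v) w + minner g x (covD g X x w) v = 0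

/-- `X` has unit length on `U`. -/
def IsUnitOn {n : ℕ} (U : Set (Pt n)) (g : Met n) (X : Pt n → Pt n) : Prop :=
  ∀ x ∈ U, minner g x (X x) (X x) = 1

/-- The Lie bracket `[X,Y]` of two vector fields, in coordinates. -/
def lieB {n : ℕ} (X Y : Pt n → Pt n) (x : Pt n) : Pt n :=
  fun k => fderiv ℝ (fun y => Y y k) x (X x) - fderiv ℝ (fun y => X y k) x (Y x)

/-- A parametrized hypersurface `F : V → ℝ^{n+1}` with a chosen unit normal field `N`. -/
structure Hyp (n : ℕ) where
  V : Set (Pt n)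
  F : Pt n → Pt (n+1)
  N : Pt n → Pt (n+1)

/-- The ambient covariant derivative, along the map `F`, of the ambient-vector-valued
field `W` defined on the parameter domain, in the coordinate direction `v`. -/
def covAlong {n : ℕ} (g : Met (n+1)) (F W : Pt n → Pt (n+1)) (u v : Pt n) : Pt (n+1) :=
  fun k => fderiv ℝ (fun y => W y k) u v +
    ∑ i, ∑ j, christoffel g (F u) k i j * fderiv ℝ F u v i * W u j

/-- `S` is a smooth immersed hypersurface inside the chart `U`, with unit normal `N`. -/
def Hyp.IsRegular {n : ℕ} (S : Hyp n) (U : Set (Pt (n+1))) (g : Met (n+1)) : Prop :=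
  IsOpen S.V ∧ ContDiffOn ℝ (⊤ : ℕ∞) S.F S.V ∧ (∀ u ∈ S.V, S.F u ∈ U) ∧
  (∀ u ∈ S.V, LinearIndependent ℝ (fun a : Fin n => fderiv ℝ S.F u (stdb n a))) ∧
  ContDiffOn ℝ (⊤ : ℕ∞) S.N S.V ∧
  (∀ u ∈ S.V, minner g (S.F u) (S.N u) (S.N u) = 1) ∧
  (∀ u ∈ S.V, ∀ a : Fin n, minner g (S.F u) (S.N u) (fderiv ℝ S.F u (stdb n a)) = 0)

/-- `S` is totally geodesic: the shape operator `X ↦ -∇̃_X N` vanishes. -/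
def Hyp.TotallyGeodesic {n : ℕ} (S : Hyp n) (g : Met (n+1)) : Prop :=
  ∀ u ∈ S.V, ∀ a : Fin n, covAlong g S.F S.N u (stdb n a) = 0

/-- `S` is totally umbilical: the shape operator `X ↦ -∇̃_X N` is pointwise a
multiple of the identity. -/
def Hyp.TotallyUmbilical {n : ℕ} (S : Hyp n) (g : Met (n+1)) : Prop :=
  ∃ lam : Pt n → ℝ, ∀ u ∈ S.V, ∀ a : Fin n,
    covAlong g S.F S.N u (stdb n a) = lam u • fderiv ℝ S.F u (stdb n a)

/-- Projection onto the first `n` coordinates. -/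
def projBase {n : ℕ} (x : Pt (n+1)) : Pt n := fun i => x i.castSucc

/-- The product metric of `g₀` with the Euclidean line (last coordinate). -/
def prodMet {n : ℕ} (g₀ : Met n) : Met (n+1) := fun x i j =>
  Fin.lastCases (Fin.lastCases 1 (fun _ => 0) j)
    (fun i' => Fin.lastCases 0 (fun j' => g₀ (projBase x) i' j') j) i

/-- The coordinate domain of a product `𝕄 × I`. -/
def prodDom {n : ℕ} (U₀ : Set (Pt n)) (I : Set ℝ) : Set (Pt (n+1)) :=
  {x | projBase x ∈ U₀ ∧ x (Fin.last n) ∈ I}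

/-- The unit vertical field `ξ` of a product `𝕄 × I`. -/
def vert (n : ℕ) : Pt (n+1) → Pt (n+1) := fun _ => stdb (n+1) (Fin.last n)

/-- The pullback of the metric `g` under the map `Φ`. -/
def pullMet {n : ℕ} (g : Met n) (Φ : Pt n → Pt n) : Met n :=
  fun x i j => minner g (Φ x) (fderiv ℝ Φ x (stdb n i)) (fderiv ℝ Φ x (stdb n j))

/-- `g` has, on the coordinate domain `W`, the shape `dt² + f(t)² g_M` of a warped
product of an interval (the `0`-th coordinate) with an `n`-dimensional manifold. -/
def IsWarpedForm {n : ℕ} (g : Met (n+1)) (W : Set (Pt (n+1))) : Prop :=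
  ∃ f : ℝ → ℝ, ContDiff ℝ (⊤ : ℕ∞) f ∧ (∀ t, 0 < f t) ∧
    ∀ x ∈ W, g x 0 0 = 1 ∧
      (∀ i : Fin (n+1), i ≠ 0 → g x 0 i = 0 ∧ g x i 0 = 0) ∧
      (∀ i j : Fin (n+1), i ≠ 0 → j ≠ 0 →
        fderiv ℝ (fun y => g y i j / f (y 0) ^ 2) x (stdb (n+1) 0) = 0)

/-- The Riemannian manifold `(U₀, g₀)` has, in a neighborhood of `p`, the structure of a
warped product of an interval of the Euclidean line with an `n`-dimensional manifold:
there is a diffeomorphism `Φ` from a coordinate domain `W` onto a neighborhood of `p`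
pulling `g₀` back to a warped-product metric. -/
def LocallyWarpedAt {n : ℕ} (U₀ : Set (Pt (n+1))) (g₀ : Met (n+1)) (p : Pt (n+1)) : Prop :=
  ∃ (W : Set (Pt (n+1))) (Φ Ψ : Pt (n+1) → Pt (n+1)),
    IsOpen W ∧ ContDiffOn ℝ (⊤ : ℕ∞) Φ W ∧ MapsTo Φ W U₀ ∧
    IsOpen (Φ '' W) ∧ p ∈ Φ '' W ∧
    ContDiffOn ℝ (⊤ : ℕ∞) Ψ (Φ '' W) ∧ (∀ w ∈ W, Ψ (Φ w) = w) ∧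
    IsWarpedForm (pullMet g₀ Φ) W

/-- The Levi-Civita symbol on three indices. -/
def lcSymb (i j k : Fin 3) : ℝ :=
  ((j.val : ℝ) - (i.val : ℝ)) * ((k.val : ℝ) - (i.val : ℝ)) * ((k.val : ℝ) - (j.val : ℝ)) / 2

/-- The cross product of `v` and `w` at `x`, with respect to the metric `g` and the
orientation of the chart. -/
def crossG (g : Met 3) (x v w : Pt 3) : Pt 3 :=
  fun k => Real.sqrt (Matrix.det (Matrix.of (g x))) *
    ∑ l, ginv g x k l * ∑ i, ∑ j, lcSymb l i j * v i * w j

/-- The components `Rˡᵢⱼₖ` of the Riemann curvature tensor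
(`R(∂ᵢ,∂ⱼ)∂ₖ = Rˡᵢⱼₖ ∂ₗ`, with `R(X,Y) = ∇_X∇_Y - ∇_Y∇_X - ∇_{[X,Y]}`). -/
def riem {n : ℕ} (g : Met n) (x : Pt n) (l i j k : Fin n) : ℝ :=
  fderiv ℝ (fun y => christoffel g y l j k) x (stdb n i)
  - fderiv ℝ (fun y => christoffel g y l i k) x (stdb n j)
  + ∑ m, (christoffel g x l i m * christoffel g x m j k
      - christoffel g x l j m * christoffel g x m i k)

/-- The curvature operator `R(v,w)z` at `x`. -/
def riemVec {n : ℕ} (g : Met n) (x v w z : Pt n) : Pt n :=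
  fun l => ∑ i, ∑ j, ∑ k, riem g x l i j k * v i * w j * z k

/-- `g` has constant sectional curvature `c` on `W`. -/
def HasConstCurv {n : ℕ} (W : Set (Pt n)) (g : Met n) (c : ℝ) : Prop :=
  ∀ x ∈ W, ∀ v w : Pt n,
    minner g x (riemVec g x v w w) v
      = c * (minner g x v v * minner g x w w - (minner g x v w) ^ 2)

/-- The Ricci tensor of `g`. -/
def ricci {n : ℕ} (g : Met n) (x : Pt n) (j k : Fin n) : ℝ := ∑ i, riem g x i i j k

/-- The scalar curvature of `g`. -/
def scal {n : ℕ} (g : Met n) (x : Pt n) : ℝ := ∑ j, ∑ k, ginv g x j k * ricci g x j k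

/-- The metric `dx² + sin²θ(x) dy² + cos²θ(x) dz²` on a three-dimensional chart. -/
def tgMet (θ : ℝ → ℝ) : Met 3 := fun x i j =>
  if i = j then
    (if i = 0 then 1 else if i = 1 then (Real.sin (θ (x 0))) ^ 2 else (Real.cos (θ (x 0))) ^ 2)
  else 0

/-- The warped product metric `dt² + f(t)² g₀` (interval coordinate first). -/
def warpMet {n : ℕ} (f : ℝ → ℝ) (g₀ : Met n) : Met (n+1) := fun x i j =>
  Fin.cases (Fin.cases 1 (fun _ => 0) j)
    (fun i' => Fin.cases 0 (fun j' => f (x 0) ^ 2 * g₀ (Fin.tail x) i' j') j) i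

/-- The coordinate domain of a warped product `I ×_f 𝕄` (interval coordinate first). -/
def warpDom {n : ℕ} (I : Set ℝ) (U₀ : Set (Pt n)) : Set (Pt (n+1)) :=
  {x | x 0 ∈ I ∧ Fin.tail x ∈ U₀}

/-- The covariant acceleration of a curve `γ`, whose vanishing defines geodesics. -/
def curveAccel {n : ℕ} (g : Met n) (γ : ℝ → Pt n) (s : ℝ) : Pt n :=
  fun k => deriv (fun t => deriv (fun r => γ r k) t) s +
    ∑ i, ∑ j, christoffel g (γ s) k i j * deriv (fun r => γ r i) s * deriv (fun r => γ r j) s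

/-- The velocity of a curve. -/
def vel {n : ℕ} (γ : ℝ → Pt n) (s : ℝ) : Pt n := fun k => deriv (fun r => γ r k) s

section LocalWarpedStructure

open scoped Topology ContDiff

section Flow

/-- The fibrewise application of a continuous family of linear maps to a continuous path. -/
def pathApply (K E F : Type*) [TopologicalSpace K] [CompactSpace K]
    [NormedAddCommGroup E] [NormedSpace ℝ E] [NormedAddCommGroup F] [NormedSpace ℝ F] :
    C(K, E →L[ℝ] F) →L[ℝ] C(K, E) →L[ℝ] C(K, F) :=
  LinearMap.mkContinuous₂
    (LinearMap.mk₂ ℝ (fun (A : C(K, E →L[ℝ] F)) (γ : C(K, E)) =>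
        (⟨fun t => A t (γ t), by fun_prop⟩ : C(K, F)))
      (fun _ _ _ => by ext; simp) (fun _ _ _ => by ext; simp)
      (fun _ _ _ => by ext; simp) (fun _ _ _ => by ext; simp)) 1
    (fun A γ => by
      rw [ContinuousMap.norm_le _ (by positivity)]
      intro t
      rw [one_mul]
      exact ((A t).le_opNorm _).trans
        (mul_le_mul (A.norm_coe_le_norm t) (γ.norm_coe_le_norm t) (norm_nonneg _)
          (norm_nonneg A)))

@[simp] lemma pathApply_apply {K E F : Type*} [TopologicalSpace K] [CompactSpace K]
    [NormedAddCommGroup E] [NormedSpace ℝ E] [NormedAddCommGroup F] [NormedSpace ℝ F]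
    (A : C(K, E →L[ℝ] F)) (γ : C(K, E)) (t : K) : pathApply K E F A γ t = A t (γ t) := rfl

/-- Composition with a `C¹` map is differentiable on the space of continuous paths. -/
lemma hasFDerivAt_postcomp {K E F : Type*} [TopologicalSpace K] [CompactSpace K]
    [NormedAddCommGroup E] [NormedSpace ℝ E] [NormedAddCommGroup F] [NormedSpace ℝ F]
    (v : C(E, F)) (v' : C(E, E →L[ℝ] F)) (hv : ∀ x, HasFDerivAt v (v' x) x) (γ : C(K, E)) :
    HasFDerivAt (fun γ : C(K, E) => v.comp γ) (pathApply K E F (v'.comp γ)) γ := by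
  rw [hasFDerivAt_iff_isLittleO_nhds_zero, Asymptotics.isLittleO_iff]
  intro ε hε
  have hc : Continuous fun γ : C(K, E) => v'.comp γ := ContinuousMap.continuous_postcomp v'
  obtain ⟨δ, hδ, hδε⟩ := Metric.continuousAt_iff (α := C(K, E)) (β := C(K, E →L[ℝ] F)).1
    (hc.continuousAt (x := γ)) ε hε
  filter_upwards [Metric.ball_mem_nhds (0 : C(K, E)) hδ] with η hη
  rw [ContinuousMap.norm_le _ (by positivity)]
  intro t
  have hηt : ‖η t‖ < δ := (η.norm_coe_le_norm t).trans_lt (by simpa using hη)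
  have key : ‖v (γ t + η t) - v (γ t) - v' (γ t) (γ t + η t - γ t)‖ ≤
      ε * ‖γ t + η t - γ t‖ := by
    refine (convex_ball (γ t) δ).norm_image_sub_le_of_norm_hasFDerivWithin_le'
      (f' := fun x => v' x) (fun x _ => (hv x).hasFDerivWithinAt) ?_
      (Metric.mem_ball_self hδ) (by simpa [mem_ball_iff_norm] using hηt)
    intro y hy
    have hd : dist (γ + ContinuousMap.const K (y - γ t)) γ < δ := by
      rw [dist_eq_norm, add_sub_cancel_left, ContinuousMap.norm_lt_iff _ hδ]
      intro s
      simpa [dist_eq_norm] using hy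
    have h2 := (ContinuousMap.dist_apply_le_dist t).trans (hδε hd).le
    simpa [dist_eq_norm] using h2
  rw [add_sub_cancel_left] at key
  exact key.trans (mul_le_mul_of_nonneg_left (η.norm_coe_le_norm t) hε.le)

universe u in
set_option maxSynthPendingDepth 5 in
/-- Composition with a smooth map is smooth on the space of continuous paths. -/
lemma contDiff_postcomp {K : Type*} {E : Type u} [TopologicalSpace K] [CompactSpace K]
    [NormedAddCommGroup E] [NormedSpace ℝ E] (n : ℕ) :
    ∀ {F : Type u} [NormedAddCommGroup F] [NormedSpace ℝ F] (v : C(E, F)),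
      ContDiff ℝ ∞ v → ContDiff ℝ n (fun γ : C(K, E) => v.comp γ) := by
  induction n with
  | zero =>
    intro F _ _ v _
    exact contDiff_zero.2 (ContinuousMap.continuous_postcomp v)
  | succ n ih =>
    intro F _ _ v hv
    obtain ⟨h1, h2⟩ := contDiff_infty_iff_fderiv.1 hv
    let v' : C(E, E →L[ℝ] F) := ⟨fderiv ℝ v, h2.continuous⟩
    have h3 := ih v' h2
    have h4 : ContDiff ℝ n (fun γ : C(K, E) => pathApply K E F (v'.comp γ)) :=
      ContDiff.comp (g := fun A => pathApply K E F A) (pathApply K E F).contDiff h3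
    exact contDiff_succ_iff_hasFDerivAt.2 ⟨fun γ => pathApply K E F (v'.comp γ),
      h4, fun γ => hasFDerivAt_postcomp v v' (fun x => (h1 x).hasFDerivAt) γ⟩

lemma neg_one_le_one : (-1 : ℝ) ≤ 1 := by norm_num

/-- The Volterra operator `γ ↦ ∫₀ᵗ γ` on paths parametrized by `[-1, 1]`. -/
def pathIntegral (E : Type*) [NormedAddCommGroup E] [NormedSpace ℝ E] :
    C(Icc (-1 : ℝ) 1, E) →L[ℝ] C(Icc (-1 : ℝ) 1, E) :=
  LinearMap.mkContinuous
    { toFun := fun γ => ⟨fun t => ∫ τ in (0 : ℝ)..t, γ (projIcc (-1) 1 neg_one_le_one τ), by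
        have hc : Continuous fun τ => γ (projIcc (-1) 1 neg_one_le_one τ) :=
          γ.continuous.comp continuous_projIcc
        exact (intervalIntegral.continuous_primitive
          (fun a b => hc.intervalIntegrable a b) 0).comp continuous_subtype_val⟩
      map_add' := fun γ η => by
        ext t
        exact intervalIntegral.integral_add
          ((γ.continuous.comp continuous_projIcc).intervalIntegrable _ _)
          ((η.continuous.comp continuous_projIcc).intervalIntegrable _ _)
      map_smul' := fun c γ => by
        ext t
        exact intervalIntegral.integral_smul c _ } 1
    (fun γ => by
      rw [ContinuousMap.norm_le _ (by positivity)]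
      intro t
      refine (intervalIntegral.norm_integral_le_of_norm_le_const
        (fun τ _ => γ.norm_coe_le_norm _)).trans ?_
      rw [one_mul, sub_zero]
      exact mul_le_of_le_one_right (norm_nonneg γ) (abs_le.2 t.2))

lemma norm_pathIntegral_le (E : Type*) [NormedAddCommGroup E] [NormedSpace ℝ E] :
    ‖pathIntegral E‖ ≤ 1 := LinearMap.mkContinuous_norm_le _ zero_le_one _

variable {E : Type*} [NormedAddCommGroup E] [NormedSpace ℝ E]

/-- The Picard operator whose fixed points are the solutions `γ` of `γ' = s v(γ)`, `γ 0 = x`,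
where `z = (s, x)`. -/
def picardMap (v : C(E, E)) (z : ℝ × E) (γ : C(Icc (-1 : ℝ) 1, E)) : C(Icc (-1 : ℝ) 1, E) :=
  ContinuousMap.const _ z.2 + z.1 • pathIntegral E (v.comp γ)

lemma contractingWith_picardMap {v : C(E, E)} {K : NNReal} (hK : LipschitzWith K v) {z : ℝ × E}
    (hz : ‖z.1‖₊ * K < 1) : ContractingWith (‖z.1‖₊ * K) (picardMap v z) := by
  refine ⟨hz, LipschitzWith.of_dist_le_mul fun γ η => ?_⟩
  have h1 : ‖v.comp γ - v.comp η‖ ≤ K * ‖γ - η‖ := by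
    rw [ContinuousMap.norm_le _ (by positivity)]
    intro t
    have h2 := hK.dist_le_mul (γ t) (η t)
    rw [dist_eq_norm, dist_eq_norm] at h2
    exact h2.trans (mul_le_mul_of_nonneg_left ((γ - η).norm_coe_le_norm t) K.2)
  rw [dist_eq_norm, dist_eq_norm, picardMap, picardMap, add_sub_add_left_eq_sub, ← smul_sub,
    ← map_sub, norm_smul, NNReal.coe_mul, coe_nnnorm, mul_assoc]
  gcongr
  calc _ ≤ ‖pathIntegral E‖ * ‖v.comp γ - v.comp η‖ := ContinuousLinearMap.le_opNorm _ _
    _ ≤ 1 * (K * ‖γ - η‖) := by gcongr; exact norm_pathIntegral_le E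
    _ = _ := one_mul _

lemma isInvertible_one_sub {X : Type*} [NormedAddCommGroup X] [NormedSpace ℝ X] [CompleteSpace X]
    {A : X →L[ℝ] X} (hA : ‖A‖ < 1) : (ContinuousLinearMap.id ℝ X - A).IsInvertible := by
  obtain ⟨u, hu⟩ := isUnit_one_sub_of_norm_lt_one hA
  exact ⟨ContinuousLinearEquiv.unitsEquiv ℝ X u, hu⟩

set_option maxSynthPendingDepth 5 in
lemma contDiffAt_of_picardMap_eq [CompleteSpace E] {v : C(E, E)} (hv : ContDiff ℝ ∞ v)
    {K : NNReal} (hK : LipschitzWith K v) {Γ : ℝ × E → C(Icc (-1 : ℝ) 1, E)}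
    (hΓ : ∀ z : ℝ × E, ‖z.1‖₊ * K < 1 → picardMap v z (Γ z) = Γ z) {z : ℝ × E}
    (hz : ‖z.1‖₊ * K < 1) : ContDiffAt ℝ ∞ Γ z := by
  let X := C(Icc (-1 : ℝ) 1, E)
  let C : E →L[ℝ] X := ContinuousLinearMap.const ℝ _
  have hvc : ContDiff ℝ ∞ (fun γ : X => v.comp γ) :=
    contDiff_infty.2 fun n => contDiff_postcomp n v hv
  let G : (ℝ × E) × X → X := fun q => q.2 - (C q.1.2 + q.1.1 • pathIntegral E (v.comp q.2))
  have hG : ContDiff ℝ ∞ G := by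
    have h1 : ContDiff ℝ ∞ fun q : (ℝ × E) × X => pathIntegral E (v.comp q.2) :=
      ContDiff.comp (g := fun γ => pathIntegral E γ) (pathIntegral E).contDiff
        (hvc.comp contDiff_snd)
    have h2 : ContDiff ℝ ∞ fun q : (ℝ × E) × X => C q.1.2 :=
      ContDiff.comp (g := fun x => C x) C.contDiff (contDiff_snd.comp contDiff_fst)
    exact contDiff_snd.sub (h2.add ((contDiff_fst.comp contDiff_fst).smul h1))
  obtain ⟨h1, h2⟩ := contDiff_infty_iff_fderiv.1 hv
  let v' : C(E, E →L[ℝ] E) := ⟨fderiv ℝ v, h2.continuous⟩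
  let A : X →L[ℝ] X := z.1 • (pathIntegral E ∘L pathApply _ E E (v'.comp (Γ z)))
  have hA : ‖A‖ < 1 := by
    have h3 : ‖v'.comp (Γ z)‖ ≤ K :=
      (ContinuousMap.norm_le (v'.comp (Γ z)) K.2).2 fun t => norm_fderiv_le_of_lipschitz ℝ hK
    have h4 : ‖pathApply (Icc (-1 : ℝ) 1) E E (v'.comp (Γ z))‖ ≤ K := by
      refine ContinuousLinearMap.opNorm_le_bound _ K.2 fun γ => ?_
      rw [ContinuousMap.norm_le _ (by positivity)]
      intro t
      exact ((v' (Γ z t)).le_opNorm _).trans (mul_le_mul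
        (((v'.comp (Γ z)).norm_coe_le_norm t).trans h3) (γ.norm_coe_le_norm t)
        (norm_nonneg _) K.2)
    calc ‖A‖ ≤ ‖z.1‖ * (‖pathIntegral E‖ * ‖pathApply (Icc (-1 : ℝ) 1) E E (v'.comp (Γ z))‖) := by
          rw [norm_smul]
          gcongr
          exact ContinuousLinearMap.opNorm_comp_le _ _
      _ ≤ ‖z.1‖ * (1 * K) := by gcongr; exact norm_pathIntegral_le E
      _ < 1 := by rw [one_mul]; exact_mod_cast hz
  have hGd : fderiv ℝ G (z, Γ z) ∘L .inr ℝ (ℝ × E) X = ContinuousLinearMap.id ℝ X - A := by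
    have h3 : HasFDerivAt (fun γ : X => G (z, γ))
        (fderiv ℝ G (z, Γ z) ∘L .inr ℝ (ℝ × E) X) (Γ z) :=
      HasFDerivAt.comp (g := G) (Γ z)
        (hG.differentiable (by simp) (z, Γ z)).hasFDerivAt (hasFDerivAt_prodMk_right z (Γ z))
    have h4 : HasFDerivAt (fun γ : X => pathIntegral E (v.comp γ))
        (pathIntegral E ∘L pathApply _ E E (v'.comp (Γ z))) (Γ z) :=
      HasFDerivAt.comp (g := fun γ => pathIntegral E γ) (Γ z) (pathIntegral E).hasFDerivAt
        (hasFDerivAt_postcomp v v' (fun x => (h1 x).hasFDerivAt) (Γ z))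
    exact h3.unique ((hasFDerivAt_id (Γ z)).sub ((h4.const_smul z.1).const_add (C z.2)))
  have hinv : (fderiv ℝ G (z, Γ z) ∘L .inr ℝ (ℝ × E) X).IsInvertible :=
    hGd ▸ isInvertible_one_sub hA
  have hs := (hG.contDiffAt (x := (z, Γ z))).contDiffAt_implicitFunction (by simp) hinv
  refine hs.congr_of_eventuallyEq ?_
  have ho : ∀ᶠ w : ℝ × E in 𝓝 z, ‖w.1‖₊ * K < 1 :=
    (continuous_fst.nnnorm.mul continuous_const).continuousAt.eventually (gt_mem_nhds hz)
  filter_upwards [ho, hG.contDiffAt.eventually_apply_implicitFunction (by simp) hinv] with w hw he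
  have h0 : G (z, Γ z) = 0 := sub_eq_zero.2 (hΓ z hz).symm
  rw [h0] at he
  exact (contractingWith_picardMap hK hw).fixedPoint_unique' (hΓ w hw) (sub_eq_zero.1 he).symm

/-- A Lipschitz smooth vector field has a flow, smooth in time and initial point jointly. -/
theorem exists_contDiff_flow [CompleteSpace E] {v : E → E} (hv : ContDiff ℝ ∞ v)
    {K : NNReal} (hK : LipschitzWith K v) :
    ∃ δ > 0, ∃ θ : ℝ × E → E, (∀ s x, |s| < δ → ContDiffAt ℝ ∞ θ (s, x)) ∧
      (∀ x, θ (0, x) = x) ∧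
      ∀ s x, |s| < δ → HasDerivAt (fun r => θ (r, x)) (v (θ (s, x))) s := by
  let w : C(E, E) := ⟨v, hv.continuous⟩
  have hex : ∀ z : ℝ × E, ∃ γ, ‖z.1‖₊ * K < 1 → picardMap w z γ = γ := fun z => by
    by_cases hz : ‖z.1‖₊ * K < 1
    · exact ⟨_, fun _ => (contractingWith_picardMap (v := w) hK hz).fixedPoint_isFixedPt⟩
    · exact ⟨0, fun h => absurd h hz⟩
  choose Γ hΓ using hex
  have hΓt : ∀ z : ℝ × E, ‖z.1‖₊ * K < 1 → ∀ t : Icc (-1 : ℝ) 1,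
      Γ z t = z.2 + z.1 • ∫ τ in (0 : ℝ)..t, v (Γ z (projIcc (-1) 1 neg_one_le_one τ)) :=
    fun z hz t => (DFunLike.congr_fun (hΓ z hz) t).symm
  have hδ : ∃ δ : ℝ, 0 < δ ∧ ∀ s : ℝ, |s| ≤ δ → ‖s‖₊ * K < 1 := by
    refine ⟨1 / (K + 1), by positivity, fun s hs => ?_⟩
    rw [← NNReal.coe_lt_coe]
    push_cast
    rw [Real.norm_eq_abs]
    have hK0 : (0 : ℝ) ≤ K := K.2
    calc |s| * K ≤ 1 / (K + 1) * K := by gcongr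
      _ < 1 := by rw [one_div_mul_eq_div, div_lt_one (by positivity)]; linarith
  obtain ⟨δ, hδ0, hδ⟩ := hδ
  let one : Icc (-1 : ℝ) 1 := ⟨1, by norm_num, le_rfl⟩
  let F : E → ℝ → E := fun x u => v (Γ (δ, x) (projIcc (-1) 1 neg_one_le_one u))
  have hF : ∀ x, Continuous (F x) := fun x =>
    hv.continuous.comp ((Γ (δ, x)).continuous.comp continuous_projIcc)
  have hint : ∀ x, ∀ u ∈ Icc (-1 : ℝ) 1, Γ (δ, x) (projIcc (-1) 1 neg_one_le_one u) =
      x + δ • ∫ τ in (0 : ℝ)..u, F x τ := fun x u hu => by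
    rw [projIcc_of_mem neg_one_le_one hu]
    exact hΓt (δ, x) (hδ δ (abs_of_pos hδ0).le) ⟨u, hu⟩
  have hquot : ∀ s, |s| < δ → |s / δ| ≤ 1 := fun s hs => by
    rw [abs_div, abs_of_pos hδ0]
    exact (div_le_one hδ0).2 hs.le
  have hresc : ∀ s x, |s| < δ →
      Γ (s, x) one = Γ (δ, x) (projIcc (-1) 1 neg_one_le_one (s / δ)) := by
    intro s x hs
    have hc := hquot s hs
    set c := s / δ with hcdef
    have hsc : s = δ * c := by rw [hcdef]; field_simp
    let β : C(Icc (-1 : ℝ) 1, E) :=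
      ⟨fun t => Γ (δ, x) (projIcc (-1) 1 neg_one_le_one (c * t)),
        (Γ (δ, x)).continuous.comp (continuous_projIcc.comp
          (continuous_const.mul continuous_subtype_val))⟩
    have hβ : picardMap w (s, x) β = β := by
      ext t
      have hct : c * t ∈ Icc (-1 : ℝ) 1 := by
        rw [mem_Icc, ← abs_le, abs_mul]
        exact mul_le_one₀ hc (abs_nonneg _) (abs_le.2 t.2)
      have h1 : β t = x + δ • ∫ τ in (0 : ℝ)..c * t, F x τ := hint x _ hct
      have h2 : picardMap w (s, x) β t = x + s • ∫ τ in (0 : ℝ)..t, F x (c * τ) := by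
        change x + s • ∫ τ in (0 : ℝ)..t, v (β (projIcc (-1) 1 neg_one_le_one τ)) = _
        congr 2
        refine intervalIntegral.integral_congr fun τ hτ => ?_
        have hτ' : τ ∈ Icc (-1 : ℝ) 1 :=
          uIcc_subset_Icc (show (0 : ℝ) ∈ Icc (-1 : ℝ) 1 by simp) t.2 hτ
        simp only [projIcc_of_mem neg_one_le_one hτ']
        rfl
      rw [h1, h2, hsc, mul_smul, intervalIntegral.smul_integral_comp_mul_left, mul_zero]
    have h3 := (contractingWith_picardMap (v := w) hK (z := (s, x))
      (hδ s hs.le)).fixedPoint_unique' (hΓ (s, x) (hδ s hs.le)) hβ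
    rw [h3]
    change Γ (δ, x) (projIcc (-1) 1 neg_one_le_one (c * 1)) = _
    rw [mul_one]
  refine ⟨δ, hδ0, fun z => Γ z one, fun s x hs => ?_, fun x => ?_, fun s x hs => ?_⟩
  · have h1 := contDiffAt_of_picardMap_eq (v := w) hv hK hΓ (z := (s, x)) (hδ s hs.le)
    have h2 : ContDiff ℝ ∞ fun γ : C(Icc (-1 : ℝ) 1, E) => γ one :=
      (ContinuousMap.evalCLM ℝ one : C(Icc (-1 : ℝ) 1, E) →L[ℝ] E).contDiff
    exact h2.contDiffAt.comp (s, x) h1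
  · have h1 := hΓt (0, x) (hδ 0 (by simpa using hδ0.le)) one
    simpa using h1
  · have h1 : HasDerivAt (fun r => x + δ • ∫ τ in (0 : ℝ)..r / δ, F x τ)
        (δ • ((1 / δ) • F x (s / δ))) s :=
      ((HasDerivAt.scomp s (intervalIntegral.integral_hasDerivAt_right
        ((hF x).intervalIntegrable _ _) ((hF x).stronglyMeasurableAtFilter _ _)
        (hF x).continuousAt) ((hasDerivAt_id s).div_const δ)).const_smul δ).const_add x
    rw [smul_smul, mul_one_div_cancel hδ0.ne', one_smul] at h1
    have h2 : v (Γ (s, x) one) = F x (s / δ) := by rw [hresc s x hs]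
    rw [h2]
    refine h1.congr_of_eventuallyEq ?_
    filter_upwards [(continuous_abs.continuousAt (x := s)).eventually (gt_mem_nhds hs)] with r hr
    rw [hresc r x hr, hint x _ (abs_le.1 (hquot r hr))]

end Flow

lemma contDiff_bump_smul {E F : Type*} [NormedAddCommGroup E] [NormedSpace ℝ E]
    [HasContDiffBump E] [FiniteDimensional ℝ E] [NormedAddCommGroup F] [NormedSpace ℝ F]
    {p : E} (χ : ContDiffBump p) {v : E → F} {U : Set E} (hU : IsOpen U)
    (hχ : Metric.closedBall p χ.rOut ⊆ U) (hv : ContDiffOn ℝ ∞ v U) :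
    ContDiff ℝ ∞ fun x => χ x • v x := by
  rw [contDiff_iff_contDiffAt]
  intro x
  by_cases hx : x ∈ U
  · exact χ.contDiffAt.smul (hv.contDiffAt (hU.mem_nhds hx))
  · have hx' : x ∈ (tsupport χ)ᶜ := fun h => hx (hχ (χ.tsupport_eq ▸ h))
    refine (contDiffAt_const (c := (0 : F))).congr_of_eventuallyEq ?_
    filter_upwards [(isClosed_tsupport χ).isOpen_compl.mem_nhds hx'] with y hy
    rw [image_eq_zero_of_notMem_tsupport hy, zero_smul]

/-- A smooth vector field on an open set has a local flow, jointly smooth. -/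
theorem exists_local_flow {E : Type*} [NormedAddCommGroup E] [NormedSpace ℝ E]
    [FiniteDimensional ℝ E] {v : E → E} {U : Set E} (hU : IsOpen U) (hv : ContDiffOn ℝ ∞ v U)
    {p : E} (hp : p ∈ U) :
    ∃ θ : ℝ × E → E, (∀ x, θ (0, x) = x) ∧ ∀ᶠ z in 𝓝 ((0 : ℝ), p), ContDiffAt ℝ ∞ θ z ∧
      θ z ∈ U ∧ HasDerivAt (fun r => θ (r, z.2)) (v (θ z)) z.1 := by
  obtain ⟨r, hr, hrU⟩ := Metric.nhds_basis_closedBall.mem_iff.1 (hU.mem_nhds hp)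
  have : ProperSpace E := FiniteDimensional.proper_real E
  have : CompleteSpace E := FiniteDimensional.complete ℝ E
  let χ : ContDiffBump p := ⟨r / 2, r, by positivity, by linarith⟩
  have hw := contDiff_bump_smul χ hU hrU hv
  have hsupp : HasCompactSupport fun x => χ x • v x := χ.hasCompactSupport.smul_right
  obtain ⟨K, hK⟩ := hw.lipschitzWith_of_hasCompactSupport hsupp (by simp)
  obtain ⟨δ, hδ, θ, hθ, hθ0, hθ'⟩ := exists_contDiff_flow hw hK
  refine ⟨θ, hθ0, ?_⟩
  have hc : Filter.Tendsto θ (𝓝 (0, p)) (𝓝 p) := by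
    have := (hθ 0 p (by simpa using hδ)).continuousAt.tendsto
    rwa [hθ0] at this
  have hs : ∀ᶠ z : ℝ × E in 𝓝 (0, p), |z.1| < δ :=
    (continuous_abs.comp continuous_fst).continuousAt.eventually
      (gt_mem_nhds (by simpa using hδ))
  filter_upwards [hs, hc.eventually (hU.mem_nhds hp), hc.eventually χ.eventuallyEq_one] with z h1 h2 h3
  refine ⟨hθ z.1 z.2 h1, h2, ?_⟩
  have := hθ' z.1 z.2 h1
  simp only [Prod.mk.eta, h3, Pi.one_apply, one_smul] at this
  exact this

section Metric

variable {n : ℕ} {U : Set (Pt n)} {g : Met n}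

/-- The derivative of the metric coefficients in the direction `u`, evaluated on `v`, `w`. -/
def dmet {n : ℕ} (g : Met n) (x u v w : Pt n) : ℝ :=
  ∑ i, ∑ j, fderiv ℝ (fun y => g y i j) x u * v i * w j

lemma minner_comm (hg : IsMetricOn U g) (x v w : Pt n) : minner g x v w = minner g x w v := by
  unfold minner
  rw [Finset.sum_comm]
  refine Finset.sum_congr rfl fun i _ => Finset.sum_congr rfl fun j _ => ?_
  rw [hg.2.1 x j i]
  ring

lemma minner_add_left (g : Met n) (x v v' w : Pt n) :
    minner g x (v + v') w = minner g x v w + minner g x v' w := by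
  simp only [minner, Pi.add_apply, mul_add, add_mul, Finset.sum_add_distrib]

lemma minner_smul_left (g : Met n) (x v w : Pt n) (c : ℝ) :
    minner g x (c • v) w = c * minner g x v w := by
  simp only [minner, Pi.smul_apply, smul_eq_mul, Finset.mul_sum]
  exact Finset.sum_congr rfl fun i _ => Finset.sum_congr rfl fun j _ => by ring

lemma minner_smul_right (g : Met n) (x v w : Pt n) (c : ℝ) :
    minner g x v (c • w) = c * minner g x v w := by
  simp only [minner, Pi.smul_apply, smul_eq_mul, Finset.mul_sum]
  exact Finset.sum_congr rfl fun i _ => Finset.sum_congr rfl fun j _ => by ring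

lemma dmet_comm (hg : IsMetricOn U g) (x u v w : Pt n) : dmet g x u v w = dmet g x u w v := by
  unfold dmet
  rw [Finset.sum_comm]
  refine Finset.sum_congr rfl fun i _ => Finset.sum_congr rfl fun j _ => ?_
  have : (fun y => g y j i) = fun y => g y i j := funext fun y => hg.2.1 y j i
  rw [this]
  ring

lemma dmet_smul (g : Met n) (x u v w : Pt n) (c : ℝ) :
    dmet g x (c • u) v w = c * dmet g x u v w := by
  simp only [dmet, map_smul, smul_eq_mul, Finset.mul_sum]
  exact Finset.sum_congr rfl fun i _ => Finset.sum_congr rfl fun j _ => by ring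

lemma apply_eq_sum_stdb (L : Pt n →L[ℝ] ℝ) (w : Pt n) : L w = ∑ i, w i * L (stdb n i) := by
  conv_lhs => rw [pi_eq_sum_univ' w, map_sum]
  refine Finset.sum_congr rfl fun i _ => ?_
  rw [map_smul, smul_eq_mul]
  congr 2

lemma dmet_eq_sum (g : Met n) (x u v w : Pt n) : dmet g x u v w =
    ∑ i, ∑ j, ∑ m, fderiv ℝ (fun y => g y i j) x (stdb n m) * u m * v i * w j := by
  unfold dmet
  refine Finset.sum_congr rfl fun i _ => Finset.sum_congr rfl fun j _ => ?_
  rw [apply_eq_sum_stdb _ u, Finset.sum_mul, Finset.sum_mul]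
  exact Finset.sum_congr rfl fun m _ => by ring

lemma isUnit_det_metric (hg : IsMetricOn U g) {x : Pt n} (hx : x ∈ U) :
    IsUnit (Matrix.of (g x)).det := by
  rw [isUnit_iff_ne_zero]
  intro h
  obtain ⟨v, hv, hv0⟩ := Matrix.exists_mulVec_eq_zero_iff.2 h
  refine (hg.2.2 x hx v hv).ne' ?_
  have h1 : minner g x v v = v ⬝ᵥ (Matrix.of (g x)).mulVec v := by
    simp only [minner, dotProduct, Matrix.mulVec, Matrix.of_apply, Finset.mul_sum]
    exact Finset.sum_congr rfl fun i _ => Finset.sum_congr rfl fun j _ => by ring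
  rw [h1, hv0, dotProduct_zero]

lemma sum_metric_mul_christoffel (hg : IsMetricOn U g) {x : Pt n} (hx : x ∈ U) (l i j : Fin n) :
    ∑ k, g x k l * christoffel g x k i j =
      (1 / 2) * (fderiv ℝ (fun y => g y j l) x (stdb n i) + fderiv ℝ (fun y => g y i l) x (stdb n j)
        - fderiv ℝ (fun y => g y i j) x (stdb n l)) := by
  have h1 : ∀ m, ∑ k, g x k l * ginv g x k m = if l = m then 1 else 0 := fun m => by
    have := congrFun (congrFun (Matrix.mul_nonsing_inv _ (isUnit_det_metric hg hx)) l) m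
    rw [Matrix.mul_apply, Matrix.one_apply] at this
    rw [← this]
    exact Finset.sum_congr rfl fun k _ => by rw [hg.2.1 x k l]; rfl
  set S : Fin n → ℝ := fun m => fderiv ℝ (fun y => g y j m) x (stdb n i) +
    fderiv ℝ (fun y => g y i m) x (stdb n j) - fderiv ℝ (fun y => g y i j) x (stdb n m) with hS
  calc ∑ k, g x k l * christoffel g x k i j
      = ∑ k, ∑ m, g x k l * ginv g x k m * (1 / 2 * S m) := by
        refine Finset.sum_congr rfl fun k _ => ?_
        simp only [christoffel, Finset.mul_sum]
        exact Finset.sum_congr rfl fun m _ => by rw [hS]; ring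
    _ = ∑ m, (∑ k, g x k l * ginv g x k m) * (1 / 2 * S m) := by
        rw [Finset.sum_comm]
        simp only [Finset.sum_mul]
    _ = 1 / 2 * S l := by simp [h1]

/-- Koszul's formula in coordinates. -/
lemma minner_covD (hg : IsMetricOn U g) {x : Pt n} (hx : x ∈ U) (Y : Pt n → Pt n) (w z : Pt n) :
    minner g x (covD g Y x w) z = minner g x (fun k => fderiv ℝ (fun y => Y y k) x w) z +
      (1 / 2) * (dmet g x w (Y x) z + dmet g x (Y x) w z - dmet g x z w (Y x)) := by
  have h1 : covD g Y x w = (fun k => fderiv ℝ (fun y => Y y k) x w) +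
    fun k => ∑ i, ∑ j, christoffel g x k i j * w i * Y x j := rfl
  rw [h1, minner_add_left]
  congr 1
  have h2 : minner g x (fun k => ∑ i, ∑ j, christoffel g x k i j * w i * Y x j) z =
      ∑ i, ∑ j, ∑ l, (∑ k, g x k l * christoffel g x k i j) * w i * Y x j * z l := by
    simp only [minner, Finset.mul_sum, Finset.sum_mul]
    rw [Finset.sum_comm, Finset.sum_congr rfl fun l _ => Finset.sum_comm, Finset.sum_comm]
    refine Finset.sum_congr rfl fun i _ => ?_
    rw [Finset.sum_congr rfl fun l _ => Finset.sum_comm, Finset.sum_comm]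
    exact Finset.sum_congr rfl fun j _ => Finset.sum_congr rfl fun l _ =>
      Finset.sum_congr rfl fun k _ => by ring
  rw [h2]
  have h3 : dmet g x w (Y x) z =
      ∑ i, ∑ j, ∑ l, fderiv ℝ (fun y => g y j l) x (stdb n i) * w i * Y x j * z l := by
    rw [dmet_eq_sum, Finset.sum_congr rfl fun j _ => Finset.sum_comm, Finset.sum_comm]
  have h4 : dmet g x (Y x) w z =
      ∑ i, ∑ j, ∑ l, fderiv ℝ (fun y => g y i l) x (stdb n j) * Y x j * w i * z l := by
    rw [dmet_eq_sum, Finset.sum_congr rfl fun j _ => Finset.sum_comm]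
  rw [h3, h4, dmet_eq_sum g x z]
  simp only [sum_metric_mul_christoffel hg hx, ← Finset.sum_add_distrib, ← Finset.sum_sub_distrib,
    Finset.mul_sum]
  exact Finset.sum_congr rfl fun i _ => Finset.sum_congr rfl fun j _ =>
    Finset.sum_congr rfl fun l _ => by ring

end Metric

section Conformal

variable {n : ℕ} {U : Set (Pt n)} {g : Met n}

lemma minner_add_right (g : Met n) (x v w w' : Pt n) :
    minner g x v (w + w') = minner g x v w + minner g x v w' := by
  simp only [minner, Pi.add_apply, mul_add, Finset.sum_add_distrib]

lemma hasDerivAt_minner (hU : IsOpen U) (hg : IsMetricOn U g) {c X Y : ℝ → Pt n}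
    {c' X' Y' : Pt n} {t : ℝ} (hct : c t ∈ U) (hc : HasDerivAt c c' t) (hX : HasDerivAt X X' t)
    (hY : HasDerivAt Y Y' t) :
    HasDerivAt (fun s => minner g (c s) (X s) (Y s))
      (dmet g (c t) c' (X t) (Y t) + minner g (c t) X' (Y t) + minner g (c t) (X t) Y') t := by
  simp only [minner, dmet, ← Finset.sum_add_distrib]
  refine HasDerivAt.fun_sum fun i _ => HasDerivAt.fun_sum fun j _ => ?_
  have h1 : HasFDerivAt (fun y => g y i j) (fderiv ℝ (fun y => g y i j) (c t)) (c t) :=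
    (((hg.1 i j).contDiffAt (hU.mem_nhds hct)).differentiableAt (by simp)).hasFDerivAt
  have h2 := ((h1.comp_hasDerivAt t hc).mul (hasDerivAt_pi.1 hX i)).mul (hasDerivAt_pi.1 hY j)
  refine h2.congr_deriv ?_
  simp only [Function.comp_apply, Pi.mul_apply]
  ring

lemma hasDerivAt_line {F : Type*} [NormedAddCommGroup F] [NormedSpace ℝ F] {Y : Pt n → F}
    {x : Pt n} (hY : DifferentiableAt ℝ Y x) (w : Pt n) :
    HasDerivAt (fun s : ℝ => Y (x + s • w)) (fderiv ℝ Y x w) 0 :=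
  hY.hasFDerivAt.hasLineDerivAt w

lemma contDiffOn_minner (hg : IsMetricOn U g) {X Y : Pt n → Pt n} (hX : ContDiffOn ℝ ∞ X U)
    (hY : ContDiffOn ℝ ∞ Y U) : ContDiffOn ℝ ∞ (fun x => minner g x (X x) (Y x)) U := by
  unfold minner
  exact ContDiffOn.sum fun i _ => ContDiffOn.sum fun j _ =>
    ((hg.1 i j).mul (contDiffOn_pi.1 hX i)).mul (contDiffOn_pi.1 hY j)

/-- The length of the vector field `V`. -/
def vecLen (g : Met n) (V : Pt n → Pt n) (x : Pt n) : ℝ := √(minner g x (V x) (V x))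

/-- The unit vector field in the direction of `V`. -/
def unitVec (g : Met n) (V : Pt n → Pt n) (x : Pt n) : Pt n := (vecLen g V x)⁻¹ • V x

variable {V : Pt n → Pt n} {f : Pt n → ℝ} {x : Pt n}

lemma vecLen_pos (hg : IsMetricOn U g) (hV0 : ∀ x ∈ U, V x ≠ 0) (hx : x ∈ U) :
    0 < vecLen g V x :=
  Real.sqrt_pos.2 (hg.2.2 x hx _ (hV0 x hx))

lemma vecLen_sq (hg : IsMetricOn U g) (hV0 : ∀ x ∈ U, V x ≠ 0) (hx : x ∈ U) :
    vecLen g V x ^ 2 = minner g x (V x) (V x) :=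
  Real.sq_sqrt (hg.2.2 x hx _ (hV0 x hx)).le

lemma contDiffOn_vecLen (hg : IsMetricOn U g) (hVs : ContDiffOn ℝ ∞ V U)
    (hV0 : ∀ x ∈ U, V x ≠ 0) : ContDiffOn ℝ ∞ (vecLen g V) U :=
  (contDiffOn_minner hg hVs hVs).sqrt fun x hx => (hg.2.2 x hx _ (hV0 x hx)).ne'

lemma contDiffOn_unitVec (hg : IsMetricOn U g) (hVs : ContDiffOn ℝ ∞ V U)
    (hV0 : ∀ x ∈ U, V x ≠ 0) : ContDiffOn ℝ ∞ (unitVec g V) U :=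
  ((contDiffOn_vecLen hg hVs hV0).inv fun _ hx => (vecLen_pos hg hV0 hx).ne').smul hVs

lemma minner_unitVec_self (hg : IsMetricOn U g) (hV0 : ∀ x ∈ U, V x ≠ 0) (hx : x ∈ U) :
    minner g x (unitVec g V x) (unitVec g V x) = 1 := by
  have := (vecLen_pos hg hV0 hx).ne'
  rw [unitVec, minner_smul_left, minner_smul_right, ← vecLen_sq hg hV0 hx]
  field_simp

lemma koszul (hU : IsOpen U) (hg : IsMetricOn U g) (hVs : ContDiffOn ℝ ∞ V U)
    (hcc : ∀ x ∈ U, ∀ w : Pt n, covD g V x w = f x • w) (hx : x ∈ U) (w z : Pt n) :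
    minner g x (fderiv ℝ V x w) z +
      (1 / 2) * (dmet g x w (V x) z + dmet g x (V x) w z - dmet g x z w (V x)) =
      f x * minner g x w z := by
  have h := minner_covD hg hx V w z
  rw [hcc x hx, minner_smul_left] at h
  rw [h]
  congr 2
  funext k
  have hV := (hVs.contDiffAt (hU.mem_nhds hx)).differentiableAt (by simp)
  rw [fderiv_apply hV]
  rfl

lemma fderiv_vecLen (hU : IsOpen U) (hg : IsMetricOn U g) (hVs : ContDiffOn ℝ ∞ V U)
    (hV0 : ∀ x ∈ U, V x ≠ 0) (hcc : ∀ x ∈ U, ∀ w : Pt n, covD g V x w = f x • w) (hx : x ∈ U)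
    (w : Pt n) : fderiv ℝ (vecLen g V) x w = f x * minner g x (unitVec g V x) w := by
  have hr := (vecLen_pos hg hV0 hx).ne'
  have hV := (hVs.contDiffAt (hU.mem_nhds hx)).differentiableAt (by simp)
  have hL := ((contDiffOn_vecLen hg hVs hV0).contDiffAt (hU.mem_nhds hx)).differentiableAt (by simp)
  refine (hasDerivAt_line hL w).unique ?_
  have h1 := (hasDerivAt_minner hU hg (by simpa) (hasDerivAt_line differentiableAt_id w)
    (hasDerivAt_line hV w) (hasDerivAt_line hV w)).sqrt
    (by simpa using (hg.2.2 x hx _ (hV0 x hx)).ne')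
  refine h1.congr_deriv ?_
  have hk := koszul hU hg hVs hcc hx w (V x)
  rw [dmet_comm hg x (V x) w (V x)] at hk
  simp only [id, zero_smul, add_zero, fderiv_id, ContinuousLinearMap.id_apply]
  rw [minner_comm hg x (V x) (fderiv ℝ V x w), unitVec, minner_smul_left, minner_comm hg x _ w]
  change _ / (2 * vecLen g V x) = _
  field_simp
  linarith

lemma fderiv_unitVec (hU : IsOpen U) (hg : IsMetricOn U g) (hVs : ContDiffOn ℝ ∞ V U)
    (hV0 : ∀ x ∈ U, V x ≠ 0) (hcc : ∀ x ∈ U, ∀ w : Pt n, covD g V x w = f x • w) (hx : x ∈ U)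
    (w : Pt n) : fderiv ℝ (unitVec g V) x w = (vecLen g V x)⁻¹ • fderiv ℝ V x w +
      (-(f x * minner g x (unitVec g V x) w) / vecLen g V x ^ 2) • V x := by
  have hr := (vecLen_pos hg hV0 hx).ne'
  have hV := (hVs.contDiffAt (hU.mem_nhds hx)).differentiableAt (by simp)
  have hL := ((contDiffOn_vecLen hg hVs hV0).contDiffAt (hU.mem_nhds hx)).differentiableAt (by simp)
  have hN := ((contDiffOn_unitVec hg hVs hV0).contDiffAt (hU.mem_nhds hx)).differentiableAt
    (by simp)
  refine (hasDerivAt_line hN w).unique ?_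
  refine (((hasDerivAt_line hL w).inv (by simpa)).smul (hasDerivAt_line hV w)).congr_deriv ?_
  simp [fderiv_vecLen hU hg hVs hV0 hcc hx]

/-- The Lie derivative of the metric along the unit vector field. -/
lemma lieDeriv_unitVec (hU : IsOpen U) (hg : IsMetricOn U g) (hVs : ContDiffOn ℝ ∞ V U)
    (hV0 : ∀ x ∈ U, V x ≠ 0) (hcc : ∀ x ∈ U, ∀ w : Pt n, covD g V x w = f x • w) (hx : x ∈ U)
    (w z : Pt n) : dmet g x (unitVec g V x) w z + minner g x (fderiv ℝ (unitVec g V) x w) z +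
      minner g x w (fderiv ℝ (unitVec g V) x z) = 2 * f x / vecLen g V x * (minner g x w z -
        minner g x (unitVec g V x) w * minner g x (unitVec g V x) z) := by
  have hr := (vecLen_pos hg hV0 hx).ne'
  have h1 := koszul hU hg hVs hcc hx w z
  have h2 := koszul hU hg hVs hcc hx z w
  rw [minner_comm hg x _ w, dmet_comm hg x z, dmet_comm hg x (V x), dmet_comm hg x w,
    minner_comm hg x z w] at h2
  rw [fderiv_unitVec hU hg hVs hV0 hcc hx, fderiv_unitVec hU hg hVs hV0 hcc hx]
  simp only [unitVec, dmet_smul, minner_add_left, minner_add_right, minner_smul_left,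
    minner_smul_right, minner_comm hg x w (V x)]
  field_simp
  linear_combination vecLen g V x ^ 2 * (h1 + h2)

end Conformal

section Coordinates

lemma injective_isInvertible {E : Type*} [NormedAddCommGroup E] [NormedSpace ℝ E]
    [FiniteDimensional ℝ E] {L : E →L[ℝ] E} (hL : Function.Injective L) :
    L ∈ range ((↑) : (E ≃L[ℝ] E) → E →L[ℝ] E) :=
  ⟨(LinearEquiv.ofInjectiveEndo L.toLinearMap hL).toContinuousLinearEquiv, by ext; rfl⟩

/-- The inverse function theorem, with a smooth inverse on the whole target. -/
lemma exists_smooth_local_inverse {E : Type*} [NormedAddCommGroup E] [NormedSpace ℝ E]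
    [FiniteDimensional ℝ E] {F : E → E} {A : Set E} (hA : IsOpen A) (hF : ContDiffOn ℝ ∞ F A)
    {a : E} (ha : a ∈ A) (hinj : Function.Injective (fderiv ℝ F a)) :
    ∃ e : OpenPartialHomeomorph E E, a ∈ e.source ∧ e.source ⊆ A ∧ (∀ x, e x = F x) ∧
      ContDiffOn ℝ ∞ e.symm e.target := by
  have : CompleteSpace E := FiniteDimensional.complete ℝ E
  have hFa : ∀ x ∈ A, ContDiffAt ℝ ∞ F x := fun x hx => hF.contDiffAt (hA.mem_nhds hx)
  obtain ⟨L, hL⟩ := injective_isInvertible hinj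
  let e₀ := (hFa a ha).toOpenPartialHomeomorph F (f' := L)
    (hL ▸ ((hFa a ha).differentiableAt (by simp)).hasFDerivAt) (by simp)
  let s := A ∩ fderiv ℝ F ⁻¹' range ((↑) : (E ≃L[ℝ] E) → E →L[ℝ] E)
  have hs : IsOpen s := (hF.continuousOn_fderiv_of_isOpen hA (by simp)).isOpen_inter_preimage hA
    ContinuousLinearEquiv.isOpen
  refine ⟨e₀.restrOpen s hs, ⟨ContDiffAt.mem_toOpenPartialHomeomorph_source _ _ _, ha, L, hL⟩,
    fun x hx => hx.2.1, fun x => rfl, fun y hy => ?_⟩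
  have hx := (e₀.restrOpen s hs).map_target hy
  obtain ⟨L', hL'⟩ := hx.2.2
  exact ((e₀.restrOpen s hs).contDiffAt_symm hy (f₀' := L')
    (hL' ▸ ((hFa _ hx.2.1).differentiableAt (by simp)).hasFDerivAt)
    (hFa _ hx.2.1)).contDiffWithinAt

/-- A smooth function with non-vanishing differential is a coordinate of some chart. -/
lemma exists_level_chart {n : ℕ} {U : Set (Pt (n + 1))} (hU : IsOpen U) {r : Pt (n + 1) → ℝ}
    (hr : ContDiffOn ℝ ∞ r U) {p : Pt (n + 1)} (hp : p ∈ U) (hdr : fderiv ℝ r p ≠ 0) :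
    ∃ e : OpenPartialHomeomorph (Pt (n + 1)) (Pt (n + 1)), p ∈ e.source ∧ e.source ⊆ U ∧ e p = 0 ∧
      (∀ x, e x 0 = r x - r p) ∧ Function.Injective (fderiv ℝ e.symm 0) ∧
      ContDiffOn ℝ ∞ e.symm e.target := by
  have hrp := (hr.contDiffAt (hU.mem_nhds hp)).differentiableAt (by simp)
  obtain ⟨k, hk⟩ : ∃ k, fderiv ℝ r p (stdb (n + 1) k) ≠ 0 := by
    by_contra! h
    exact hdr (ContinuousLinearMap.ext fun w => by simp [apply_eq_sum_stdb _ w, h])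
  let H : Pt (n + 1) → Pt (n + 1) := fun x i =>
    if i = 0 then r x - r p else x (Equiv.swap 0 k i) - p (Equiv.swap 0 k i)
  have hH : ContDiffOn ℝ ∞ H U := by
    refine contDiffOn_pi.2 fun i => ?_
    by_cases hi : i = 0
    · simpa [H, hi] using hr.sub contDiffOn_const
    · simp only [H, hi, if_false]
      fun_prop
  have hHp : DifferentiableAt ℝ H p :=
    (hH.contDiffAt (hU.mem_nhds hp)).differentiableAt (by simp)
  have hinj : Function.Injective (fderiv ℝ H p) := by
    refine (injective_iff_map_eq_zero _).2 fun w hw => ?_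
    have hi : ∀ i, fderiv ℝ (fun x => H x i) p w = 0 := fun i => by
      rw [fderiv_apply hHp]
      exact congrFun hw i
    have h0 : fderiv ℝ r p w = 0 := by
      have := hi 0
      simpa [H, fderiv_sub_const] using this
    have h1 : ∀ j, j ≠ k → w j = 0 := fun j hj => by
      have hj' : Equiv.swap 0 k j ≠ 0 := fun h => hj (by
        rwa [Equiv.swap_apply_eq_iff, Equiv.swap_apply_left] at h)
      have := hi (Equiv.swap 0 k j)
      have hd : HasFDerivAt (fun x => H x (Equiv.swap 0 k j))
          (ContinuousLinearMap.proj j : Pt (n + 1) →L[ℝ] ℝ) p := by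
        simp only [H, hj', if_false, Equiv.swap_apply_self]
        exact (hasFDerivAt_apply j p).sub_const _
      rw [hd.fderiv] at this
      simpa using this
    rw [apply_eq_sum_stdb, Finset.sum_eq_single k (fun j _ hj => by simp [h1 j hj]) (by simp)] at h0
    funext j
    by_cases hj : j = k
    · exact hj ▸ (mul_eq_zero.1 h0).resolve_right hk
    · exact h1 j hj
  obtain ⟨e, hpe, heU, heH, hes⟩ := exists_smooth_local_inverse hU hH hp hinj
  have hep : e p = 0 := by
    rw [heH]
    funext i
    simp [H]
  refine ⟨e, hpe, heU, hep, fun x => by simp [heH, H], ?_, hes⟩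
  have h0 : (0 : Pt (n + 1)) ∈ e.target := hep ▸ e.map_source hpe
  have hS : DifferentiableAt ℝ e.symm 0 :=
    (hes.contDiffAt (e.open_target.mem_nhds h0)).differentiableAt (by simp)
  have hSp : e.symm 0 = p := by rw [← hep, e.left_inv hpe]
  have hcomp : HasFDerivAt (H ∘ e.symm) ((fderiv ℝ H p).comp (fderiv ℝ e.symm 0)) 0 := by
    refine HasFDerivAt.comp 0 ?_ hS.hasFDerivAt
    rw [hSp]
    exact hHp.hasFDerivAt
  have hid : H ∘ e.symm =ᶠ[𝓝 0] id := by
    filter_upwards [e.open_target.mem_nhds h0] with z hz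
    rw [Function.comp_apply, ← heH, e.right_inv hz, id]
  have := (hcomp.congr_of_eventuallyEq hid.symm).unique (hasFDerivAt_id _)
  exact Function.LeftInverse.injective (g := fderiv ℝ H p) fun w => DFunLike.congr_fun this w

/-- Near a point where the smooth vector field `v` is transverse to the level set of `r`, there
are coordinates in which `v` is the `0`-th coordinate field and the level set is `{x₀ = 0}`. -/
lemma exists_adapted_chart {n : ℕ} {U : Set (Pt (n + 1))} (hU : IsOpen U)
    {r : Pt (n + 1) → ℝ} (hr : ContDiffOn ℝ ∞ r U) {v : Pt (n + 1) → Pt (n + 1)}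
    (hv : ContDiffOn ℝ ∞ v U) {p : Pt (n + 1)} (hp : p ∈ U) (hdr : fderiv ℝ r p (v p) ≠ 0) :
    ∃ e : OpenPartialHomeomorph (Pt (n + 1)) (Pt (n + 1)), 0 ∈ e.source ∧ e 0 = p ∧
      ContDiffOn ℝ ∞ e e.source ∧ ContDiffOn ℝ ∞ e.symm e.target ∧
      (∀ x ∈ e.source, e x ∈ U ∧ fderiv ℝ e x (stdb (n + 1) 0) = v (e x)) ∧
      ∀ x ∈ e.source, x 0 = 0 → r (e x) = r p := by
  obtain ⟨c, hpc, hcU, hcp, hcr, hcinj, hcs⟩ :=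
    exists_level_chart hU hr hp (fun h => hdr (by simp [h]))
  obtain ⟨θ, hθ0, hθ⟩ := exists_local_flow hU hv hp
  have h0 : (0 : Pt (n + 1)) ∈ c.target := hcp ▸ c.map_source hpc
  have hS0 : c.symm 0 = p := by rw [← hcp, c.left_inv hpc]
  have hSd : ContDiffAt ℝ ∞ c.symm 0 := hcs.contDiffAt (c.open_target.mem_nhds h0)
  have hrS : ∀ z ∈ c.target, r (c.symm z) = r p + z 0 := fun z hz => by
    have := hcr (c.symm z)
    rw [c.right_inv hz] at this
    linarith
  let P : Pt (n + 1) →L[ℝ] Pt (n + 1) := ContinuousLinearMap.id ℝ _ -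
    (ContinuousLinearMap.proj 0 : Pt (n + 1) →L[ℝ] ℝ).smulRight (stdb (n + 1) 0)
  have hP : ∀ x, P x = x - x 0 • stdb (n + 1) 0 := fun x => rfl
  have hP0 : ∀ x, x 0 = 0 → P x = x := fun x hx => by simp [hP, hx]
  have hP1 : ∀ x (s : ℝ), P (x + s • stdb (n + 1) 0) = P x := fun x s => by
    have : P (stdb (n + 1) 0) = 0 := by simp [hP, stdb]
    rw [map_add, map_smul, this, smul_zero, add_zero]
  let Q : Pt (n + 1) → ℝ × Pt (n + 1) := fun x => (x 0, c.symm (P x))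
  let F : Pt (n + 1) → Pt (n + 1) := fun x => θ (Q x)
  have hFS : ∀ x, x 0 = 0 → F x = c.symm x := fun x hx => by simp [F, Q, hx, hθ0, hP0 x hx]
  have hPc : ContinuousAt P 0 := P.continuous.continuousAt
  have hQ0 : Q 0 = (0, p) := by simp [Q, hS0]
  have hPt : ∀ᶠ x in 𝓝 (0 : Pt (n + 1)), P x ∈ c.target :=
    hPc.eventually (c.open_target.mem_nhds (by simpa using h0))
  have hQ : ∀ x, P x ∈ c.target → ContDiffAt ℝ ∞ Q x := fun x hx =>
    (contDiff_apply ℝ ℝ (0 : Fin (n + 1))).contDiffAt.prodMk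
      ((hcs.contDiffAt (c.open_target.mem_nhds hx)).comp x P.contDiff.contDiffAt)
  have hQc : Filter.Tendsto Q (𝓝 0) (𝓝 (0, p)) :=
    hQ0 ▸ (hQ 0 (by simpa using h0)).continuousAt.tendsto
  obtain ⟨A, hA, hAo, h0A⟩ := eventually_nhds_iff.1 (hPt.and (hQc.eventually hθ))
  have hF : ∀ x ∈ A, ContDiffAt ℝ ∞ F x := fun x hx => (hA x hx).2.1.comp x (hQ x (hA x hx).1)
  have hFv : ∀ x ∈ A, fderiv ℝ F x (stdb (n + 1) 0) = v (F x) := fun x hx => by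
    have h1 := hasDerivAt_line ((hF x hx).differentiableAt (by simp)) (stdb (n + 1) 0)
    have h2 : HasDerivAt (fun s : ℝ => θ (x 0 + s, (Q x).2)) (v (F x)) 0 := by
      have := (hA x hx).2.2.2
      exact HasDerivAt.comp_const_add (x 0) 0 (by simpa using this)
    refine h1.unique (h2.congr_of_eventuallyEq (Filter.Eventually.of_forall fun s => ?_))
    simp only [F, Q, hP1]
    simp [stdb]
  have hF0 : F 0 = p := by rw [hFS 0 rfl, hS0]
  have hinj : Function.Injective (fderiv ℝ F 0) := by
    have hSl : ∀ u : Pt (n + 1), u 0 = 0 → fderiv ℝ F 0 u = fderiv ℝ c.symm 0 u := fun u hu => by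
      refine (hasDerivAt_line ((hF 0 h0A).differentiableAt (by simp)) u).unique
        ((hasDerivAt_line (hSd.differentiableAt (by simp)) u).congr_of_eventuallyEq
          (Filter.Eventually.of_forall fun s => hFS _ ?_))
      simp [hu]
    have hrd : ∀ u : Pt (n + 1), u 0 = 0 → fderiv ℝ r p (fderiv ℝ c.symm 0 u) = 0 := by
      intro u hu
      have h1 : HasFDerivAt (r ∘ c.symm) ((fderiv ℝ r p).comp (fderiv ℝ c.symm 0)) 0 := by
        refine HasFDerivAt.comp 0 ?_ (hSd.differentiableAt (by simp)).hasFDerivAt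
        rw [hS0]
        exact ((hr.contDiffAt (hU.mem_nhds hp)).differentiableAt (by simp)).hasFDerivAt
      have h2 : HasFDerivAt (r ∘ c.symm)
          (ContinuousLinearMap.proj 0 : Pt (n + 1) →L[ℝ] ℝ) 0 := by
        refine ((hasFDerivAt_apply (0 : Fin (n + 1)) _).const_add (r p)).congr_of_eventuallyEq ?_
        filter_upwards [c.open_target.mem_nhds h0] with z hz using hrS z hz
      simpa [hu] using DFunLike.congr_fun (h1.unique h2) u
    refine (injective_iff_map_eq_zero _).2 fun w hw => ?_
    have hPw : (P w) 0 = 0 := by simp [hP, stdb]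
    have hdec : fderiv ℝ F 0 w = w 0 • v p + fderiv ℝ c.symm 0 (P w) := by
      rw [← hSl _ hPw, ← hF0, ← hFv 0 h0A, ← map_smul, ← map_add, hP]
      simp
    have hw0 : w 0 = 0 := by
      have := congrArg (fderiv ℝ r p) (hdec.symm.trans hw)
      rw [map_add, map_smul, hrd _ hPw, add_zero, map_zero, smul_eq_mul] at this
      exact (mul_eq_zero.1 this).resolve_right hdr
    rw [hSl w hw0] at hw
    exact (injective_iff_map_eq_zero _).1 hcinj w hw
  obtain ⟨e, h0e, heA, heF, hes⟩ :=
    exists_smooth_local_inverse hAo (fun x hx => (hF x hx).contDiffWithinAt) h0A hinj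
  have hefun : ⇑e = F := funext heF
  refine ⟨e, h0e, by rw [hefun, hF0], ?_, hes, fun x hx => ?_, fun x hx hx0 => ?_⟩
  · rw [hefun]
    exact fun x hx => (hF x (heA hx)).contDiffWithinAt
  · rw [hefun]
    exact ⟨(hA x (heA hx)).2.2.1, hFv x (heA hx)⟩
  · rw [hefun, hFS x hx0, hrS x (hP0 x hx0 ▸ (hA x (heA hx)).1), hx0, add_zero]

end Coordinates

section Warped

variable {n : ℕ} {U s : Set (Pt n)} {g : Met n} {Φ N : Pt n → Pt n} {a : Pt n}

/-- If `Φ` maps the constant field `a` to `N`, then every `dΦ(b)` is Lie transported by `N`. -/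
lemma hasDerivAt_fderiv_line (hs : IsOpen s) (hΦ : ContDiffOn ℝ ∞ Φ s) (hU : IsOpen U)
    (hN : ContDiffOn ℝ ∞ N U) (hΦN : ∀ x ∈ s, Φ x ∈ U ∧ fderiv ℝ Φ x a = N (Φ x)) {x : Pt n}
    (hx : x ∈ s) (b : Pt n) :
    HasDerivAt (fun t : ℝ => fderiv ℝ Φ (x + t • a) b) (fderiv ℝ N (Φ x) (fderiv ℝ Φ x b)) 0 := by
  have hΦx := hΦ.contDiffAt (hs.mem_nhds hx)
  have hD : DifferentiableAt ℝ (fderiv ℝ Φ) x :=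
    (hΦx.fderiv_right (m := ∞) (by simp)).differentiableAt (by simp)
  have hN' := ((hN.contDiffAt (hU.mem_nhds (hΦN x hx).1)).differentiableAt (by simp)).hasFDerivAt
  have h1 : HasFDerivAt (fun y => fderiv ℝ Φ y a)
      ((fderiv ℝ N (Φ x)).comp (fderiv ℝ Φ x)) x := by
    refine (hN'.comp x (hΦx.differentiableAt (by simp)).hasFDerivAt).congr_of_eventuallyEq ?_
    filter_upwards [hs.mem_nhds hx] with y hy using (hΦN y hy).2
  have h2 := (hD.hasFDerivAt.clm_apply (hasFDerivAt_const a x)).unique h1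
  have h3 : fderiv ℝ (fderiv ℝ Φ) x b a = fderiv ℝ N (Φ x) (fderiv ℝ Φ x b) := by
    simpa using DFunLike.congr_fun h2 b
  have hsymm : IsSymmSndFDerivAt ℝ Φ x := hΦx.isSymmSndFDerivAt
    (by simpa using (WithTop.coe_le_coe.2 le_top : ((2 : ℕ∞) : WithTop ℕ∞) ≤ ∞))
  rw [← h3, hsymm.eq b a]
  exact ((ContinuousLinearMap.apply ℝ (Pt n) b).hasFDerivAt.comp_hasDerivAt (0 : ℝ)
    (hasDerivAt_line hD a))

lemma contDiffOn_pullMet (hs : IsOpen s) (hg : IsMetricOn U g) (hΦ : ContDiffOn ℝ ∞ Φ s)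
    (hΦU : MapsTo Φ s U) (i j : Fin n) : ContDiffOn ℝ ∞ (fun x => pullMet g Φ x i j) s := by
  have hD : ∀ k, ContDiffOn ℝ ∞ (fun x => fderiv ℝ Φ x (stdb n k)) s := fun k =>
    (hΦ.fderiv_of_isOpen hs (by simp)).clm_apply contDiffOn_const
  unfold pullMet minner
  exact ContDiffOn.sum fun k _ => ContDiffOn.sum fun l _ =>
    (((hg.1 k l).comp hΦ hΦU).mul (contDiffOn_pi.1 (hD i) k)).mul (contDiffOn_pi.1 (hD j) l)

lemma fderiv_pullMet (hs : IsOpen s) (hg : IsMetricOn U g) (hΦ : ContDiffOn ℝ ∞ Φ s)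
    (hU : IsOpen U) (hN : ContDiffOn ℝ ∞ N U)
    (hΦN : ∀ x ∈ s, Φ x ∈ U ∧ fderiv ℝ Φ x a = N (Φ x)) {x : Pt n} (hx : x ∈ s) (i j : Fin n) :
    fderiv ℝ (fun y => pullMet g Φ y i j) x a =
      dmet g (Φ x) (N (Φ x)) (fderiv ℝ Φ x (stdb n i)) (fderiv ℝ Φ x (stdb n j)) +
      minner g (Φ x) (fderiv ℝ N (Φ x) (fderiv ℝ Φ x (stdb n i))) (fderiv ℝ Φ x (stdb n j)) +
      minner g (Φ x) (fderiv ℝ Φ x (stdb n i)) (fderiv ℝ N (Φ x) (fderiv ℝ Φ x (stdb n j))) := by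
  have h1 := ((contDiffOn_pullMet hs hg hΦ (fun y hy => (hΦN y hy).1) i j).contDiffAt
    (hs.mem_nhds hx)).differentiableAt (by simp)
  have h2 := hasDerivAt_minner hU hg (by simpa using (hΦN x hx).1)
    (hasDerivAt_line ((hΦ.contDiffAt (hs.mem_nhds hx)).differentiableAt (by simp)) a)
    (hasDerivAt_fderiv_line hs hΦ hU hN hΦN hx (stdb n i))
    (hasDerivAt_fderiv_line hs hΦ hU hN hΦN hx (stdb n j))
  simpa only [zero_smul, add_zero, (hΦN x hx).2] using (hasDerivAt_line h1 a).unique h2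

lemma eq_of_fderiv_sub_eq_zero {B : Set (Pt n)} (hB : Convex ℝ B) {F : Pt n → ℝ}
    (hF : ∀ z ∈ B, DifferentiableAt ℝ F z) {x y : Pt n} (hx : x ∈ B) (hy : y ∈ B)
    (h : ∀ z ∈ B, fderiv ℝ F z (y - x) = 0) : F y = F x := by
  obtain ⟨z, hz, hz'⟩ := domain_mvt (fun z hz => (hF z hz).hasFDerivAt.hasFDerivWithinAt) hB hx hy
  rw [h z (hB.segment_subset hx hy hz)] at hz'
  linarith

end Warped

/-- If `N` is a unit field, `dr` is a non-vanishing multiple of the dual of `N`, and the Lie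
derivative of the metric along `N` is pure trace on the complement of `N`, then the
metric is locally a warped product. -/
theorem locallyWarpedAt_of_lieDeriv {n : ℕ} {U : Set (Pt (n + 1))} (hU : IsOpen U)
    {g : Met (n + 1)} (hg : IsMetricOn U g) {N : Pt (n + 1) → Pt (n + 1)}
    (hN : ContDiffOn ℝ ∞ N U) {r f : Pt (n + 1) → ℝ} (hr : ContDiffOn ℝ ∞ r U)
    (hr0 : ∀ x ∈ U, 0 < r x) (hf : ∀ x ∈ U, f x ≠ 0)
    (hN1 : ∀ x ∈ U, minner g x (N x) (N x) = 1)
    (hdr : ∀ x ∈ U, ∀ w, fderiv ℝ r x w = f x * minner g x (N x) w)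
    (hL : ∀ x ∈ U, ∀ w z, dmet g x (N x) w z + minner g x (fderiv ℝ N x w) z +
      minner g x w (fderiv ℝ N x z) =
        2 * f x / r x * (minner g x w z - minner g x (N x) w * minner g x (N x) z))
    {p : Pt (n + 1)} (hp : p ∈ U) : LocallyWarpedAt U g p := by
  obtain ⟨e, h0e, he0, hes, hesymm, heN, her⟩ := exists_adapted_chart hU hr hN hp
    (by rw [hdr p hp, hN1 p hp, mul_one]; exact hf p hp)
  have heU : MapsTo e e.source U := fun x hx => (heN x hx).1
  obtain ⟨ε, hε, hεe⟩ := Metric.isOpen_iff.1 e.open_source 0 h0e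
  set B : Set (Pt (n + 1)) := Metric.ball 0 ε with hBdef
  have hB : Convex ℝ B := convex_ball 0 ε
  set G : Fin (n + 1) → Fin (n + 1) → Pt (n + 1) → ℝ := fun i j x => pullMet g e x i j with hG
  set R : Pt (n + 1) → ℝ := fun x => r (e x) with hR
  have hGd : ∀ i j, ∀ x ∈ e.source, DifferentiableAt ℝ (G i j) x := fun i j x hx =>
    ((contDiffOn_pullMet e.open_source hg hes heU i j).contDiffAt
      (e.open_source.mem_nhds hx)).differentiableAt (by simp)
  have hRs : ContDiffOn ℝ ∞ R e.source := hr.comp hes heU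
  have hRd : ∀ x ∈ e.source, DifferentiableAt ℝ R x := fun x hx =>
    (hRs.contDiffAt (e.open_source.mem_nhds hx)).differentiableAt (by simp)
  have hG00 : ∀ x ∈ e.source, G 0 0 x = 1 := fun x hx => by
    simp only [hG, pullMet, (heN x hx).2, hN1 _ (heU hx)]
  have hG' : ∀ i j, ∀ x ∈ e.source, fderiv ℝ (G i j) x (stdb (n + 1) 0) =
      2 * f (e x) / R x * (G i j x - G 0 i x * G 0 j x) := fun i j x hx => by
    rw [fderiv_pullMet e.open_source hg hes hU hN heN hx, hL _ (heU hx)]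
    simp only [hG, pullMet, (heN x hx).2, hR]
  have hR' : ∀ i, ∀ x ∈ e.source, fderiv ℝ R x (stdb (n + 1) i) = f (e x) * G 0 i x := by
    intro i x hx
    have h1 := ((hr.contDiffAt (hU.mem_nhds (heU hx))).differentiableAt (by simp)).hasFDerivAt.comp
      x ((hes.contDiffAt (e.open_source.mem_nhds hx)).differentiableAt (by simp)).hasFDerivAt
    have h2 : fderiv ℝ R x = (fderiv ℝ r (e x)).comp (fderiv ℝ e x) := h1.fderiv
    rw [h2, ContinuousLinearMap.comp_apply, hdr _ (heU hx)]
    simp only [hG, pullMet, (heN x hx).2]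
  have hG0s : ∀ j, j ≠ 0 → ∀ x ∈ e.source, x 0 = 0 → G 0 j x = 0 := by
    intro j hj x hx hx0
    have h1 : HasDerivAt (fun t : ℝ => R (x + t • stdb (n + 1) j)) 0 0 := by
      refine (hasDerivAt_const (0 : ℝ) (r p)).congr_of_eventuallyEq ?_
      have hc : ContinuousAt (fun t : ℝ => x + t • stdb (n + 1) j) 0 := by fun_prop
      filter_upwards [hc.eventually (e.open_source.mem_nhds (by simpa using hx))] with t ht
      exact her _ ht (by simp [hx0, stdb, hj.symm])
    have h2 := (hasDerivAt_line (hRd x hx) (stdb (n + 1) j)).unique h1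
    rw [hR' j x hx] at h2
    exact (mul_eq_zero.1 h2).resolve_left (hf _ (heU hx))
  have hG0 : ∀ j, j ≠ 0 → ∀ x ∈ B, G 0 j x = 0 := by
    intro j hj x hx
    have hy : Function.update x 0 0 ∈ B := by
      rw [hBdef, mem_ball_zero_iff] at hx ⊢
      refine lt_of_le_of_lt ((pi_norm_le_iff_of_nonneg (norm_nonneg x)).2 fun i => ?_) hx
      by_cases hi : i = 0
      · simp [hi]
      · simpa [hi] using norm_le_pi_norm x i
    rw [← hG0s j hj _ (hεe hy) (by simp)]
    refine eq_of_fderiv_sub_eq_zero hB (fun z hz => hGd 0 j z (hεe hz)) hy hx fun z hz => ?_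
    have : x - Function.update x 0 0 = x 0 • stdb (n + 1) 0 := by
      funext i
      by_cases hi : i = 0 <;> simp [hi, stdb]
    rw [this, map_smul, hG' 0 j z (hεe hz), hG00 z (hεe hz)]
    simp
  have hRaxis : ∀ x ∈ B, R (x 0 • stdb (n + 1) 0) = R x := by
    intro x hx
    have hy : x 0 • stdb (n + 1) 0 ∈ B := by
      rw [hBdef, mem_ball_zero_iff] at hx ⊢
      refine lt_of_le_of_lt ((pi_norm_le_iff_of_nonneg (norm_nonneg x)).2 fun i => ?_) hx
      by_cases hi : i = 0
      · simpa [hi, stdb] using norm_le_pi_norm x 0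
      · simp [hi, stdb]
    refine eq_of_fderiv_sub_eq_zero hB (fun z hz => hRd z (hεe hz)) hx hy fun z hz => ?_
    rw [apply_eq_sum_stdb]
    refine Finset.sum_eq_zero fun i _ => ?_
    by_cases hi : i = 0
    · simp [hi, stdb]
    · rw [hR' i z (hεe hz), hG0 i hi z hz, mul_zero, mul_zero]
  let χ : ContDiffBump (0 : ℝ) := ⟨ε / 2, 3 * ε / 4, by positivity, by linarith⟩
  let h : ℝ → ℝ := fun t => Real.exp (χ t • Real.log (R (t • stdb (n + 1) 0)))
  have hh : ContDiff ℝ ∞ h := by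
    refine (contDiff_bump_smul χ (U := Metric.ball 0 ε) Metric.isOpen_ball
      (Metric.closedBall_subset_ball (show 3 * ε / 4 < ε by linarith)) ?_).exp
    have hm : MapsTo (fun t : ℝ => t • stdb (n + 1) 0) (Metric.ball 0 ε) e.source := fun t ht => by
      refine hεe ?_
      rw [mem_ball_zero_iff] at ht
      rw [hBdef, mem_ball_zero_iff, norm_smul, stdb, Pi.norm_single]
      simpa using ht
    refine ContDiffOn.log (hRs.comp (by fun_prop) hm) fun t ht => (hr0 _ (heU (hm ht))).ne'
  have hWB : Metric.ball (0 : Pt (n + 1)) (ε / 2) ⊆ B := Metric.ball_subset_ball (by linarith)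
  have hhR : ∀ x ∈ Metric.ball (0 : Pt (n + 1)) (ε / 2), h (x 0) = R x := by
    intro x hx
    have hx0 : x 0 ∈ Metric.closedBall (0 : ℝ) (ε / 2) := by
      rw [mem_ball_zero_iff] at hx
      rw [mem_closedBall_zero_iff]
      exact (norm_le_pi_norm x 0).trans hx.le
    simp only [h]
    rw [χ.one_of_mem_closedBall hx0, one_smul, hRaxis x (hWB hx),
      Real.exp_log (hr0 _ (heU (hεe (hWB hx))))]
  have hWe := hWB.trans hεe
  refine ⟨Metric.ball 0 (ε / 2), e, e.symm, Metric.isOpen_ball, hes.mono hWe,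
    heU.mono_left hWe, e.isOpen_image_of_subset_source Metric.isOpen_ball hWe,
    ⟨0, Metric.mem_ball_self (by positivity), he0⟩,
    hesymm.mono (by rintro _ ⟨x, hx, rfl⟩; exact e.map_source (hWe hx)),
    fun w hw => e.left_inv (hWe hw), h, hh, fun t => Real.exp_pos _, fun x hx =>
    ⟨hG00 x (hWe hx), fun i hi => ⟨hG0 i hi x (hWB hx), ?_⟩, fun i j hi hj => ?_⟩⟩
  · rw [pullMet, minner_comm hg]
    exact hG0 i hi x (hWB hx)
  · have hRx : R x ≠ 0 := (hr0 _ (heU (hWe hx))).ne'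
    have heq : (fun y => pullMet g e y i j / h (y 0) ^ 2) =ᶠ[𝓝 x] fun y => G i j y / R y ^ 2 := by
      filter_upwards [Metric.isOpen_ball.mem_nhds hx] with y hy
      rw [hhR y hy]
    have hR2 : DifferentiableAt ℝ (fun y => R y ^ 2) x := (hRd x (hWe hx)).fun_pow 2
    have hd : DifferentiableAt ℝ (fun y => G i j y / R y ^ 2) x := by
      simpa only [div_eq_mul_inv] using
        (hGd i j x (hWe hx)).fun_mul (hR2.fun_inv (pow_ne_zero 2 hRx))
    rw [heq.fderiv_eq]
    refine (hasDerivAt_line hd _).unique ?_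
    refine ((hasDerivAt_line (hGd i j x (hWe hx)) _).div
      ((hasDerivAt_line (hRd x (hWe hx)) _).pow 2) (by simpa)).congr_deriv ?_
    rw [hG' i j x (hWe hx), hR' 0 x (hWe hx), hG00 x (hWe hx), hG0 i hi x (hWB hx)]
    simp only [Pi.pow_apply, zero_smul, add_zero]
    field_simp
    ring

end LocalWarpedStructure

/-- Proposition 2.  If a Riemannian manifold `𝕄ⁿ` carries a closed
conformal field `V` without zeros (`∇_X V = f X` with `f` non-vanishing), then `𝕄ⁿ` has
locally the structure of a warped product of an interval of the Euclidean line with an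
`(n-1)`-dimensional Riemannian manifold: around each point there are coordinates in
which the metric takes the form `dt² + h(t)² g_{M^{n-1}}`. -/
theorem statement2 {n : ℕ} (U : Set (Pt (n+1))) (hU : IsOpen U)
    (g : Met (n+1)) (hg : IsMetricOn U g)
    (V : Pt (n+1) → Pt (n+1)) (hVs : ContDiffOn ℝ (⊤ : ℕ∞) V U)
    (hV0 : ∀ x ∈ U, V x ≠ 0)
    (f : Pt (n+1) → ℝ) (hf : ∀ x ∈ U, f x ≠ 0)
    (hcc : ∀ x ∈ U, ∀ w : Pt (n+1), covD g V x w = f x • w) :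
    ∀ p ∈ U, LocallyWarpedAt U g p := fun _ hp =>
  locallyWarpedAt_of_lieDeriv hU hg (contDiffOn_unitVec hg hVs hV0) (contDiffOn_vecLen hg hVs hV0)
    (fun _ hx => vecLen_pos hg hV0 hx) hf (fun _ hx => minner_unitVec_self hg hV0 hx)
    (fun _ hx => fderiv_vecLen hU hg hVs hV0 hcc hx)
    (fun _ hx => lieDeriv_unitVec hU hg hVs hV0 hcc hx) hp
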